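/- If U is a Milliken-Taylor ultrafilter on FIN, then U·U ≡_T U. -/

import Mathlib

open Set

/-- A subset `S` is bounded with respect to the relation `r`. -/
def RelBounded {α : Type*} (r : α → α → Prop) (S : Set α) : Prop :=
  ∃ b, ∀ a ∈ S, r a b

/-- Tukey reducibility between two ordered sets: there is a map sending every
unbounded set to an unbounded set. -/
def TukeyLE {α β : Type*} (ra : α → α → Prop) (rb : β → β → Prop) : Prop :=
  ∃ f : α → β, ∀ S : Set α, ¬ RelBounded ra S → ¬ RelBounded rb (f '' S)

/-- Tukey equivalence. -/
def TukeyEquiv {α β : Type*} (ra : α → α → Prop) (rb : β → β → Prop) : Prop :=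
  TukeyLE ra rb ∧ TukeyLE rb ra

/-- `S` is cofinal with respect to the relation `r`. -/
def IsCofinalIn {α : Type*} (r : α → α → Prop) (S : Set α) : Prop :=
  ∀ a, ∃ b ∈ S, r a b

/-- The poset `(U, ⊇)` associated to a filter `U`: `A ≤ B` iff `A ⊇ B`. -/
def filtRel {X : Type*} (U : Filter X) :
    {A : Set X // A ∈ U} → {A : Set X // A ∈ U} → Prop :=
  fun A B => B.1 ⊆ A.1

/-- The poset `(I, ⊆)` associated to a family of sets `I`. -/
def subRel {X : Type*} (I : Set (Set X)) :
    {A : Set X // A ∈ I} → {A : Set X // A ∈ I} → Prop :=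
  fun A B => A.1 ⊆ B.1

/-- The Fubini product of filters: `A ∈ U·V` iff `{x | (A)_x ∈ V} ∈ U`,
where `(A)_x = {y | (x, y) ∈ A}`. -/
def fubini {X Y : Type*} (U : Filter X) (V : Filter Y) : Filter (X × Y) :=
  U.bind fun x => V.map (Prod.mk x)

/-- The ω-fold power of an ordered set, with the everywhere (pointwise)
domination order. -/
def seqRel {α : Type*} (r : α → α → Prop) : (ℕ → α) → (ℕ → α) → Prop :=
  fun f g => ∀ n, r (f n) (g n)

/-- The product order on a Cartesian product of two ordered sets. -/
def prodRel {α β : Type*} (ra : α → α → Prop) (rb : β → β → Prop) :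
    α × β → α × β → Prop :=
  fun p q => ra p.1 q.1 ∧ rb p.2 q.2

/-- The everywhere domination order on `ω^ω`. -/
def domRel : (ℕ → ℕ) → (ℕ → ℕ) → Prop := fun f g => ∀ n, f n ≤ g n

/-- An ideal on `X`: a family of subsets containing `∅`, closed under subsets
and finite unions. -/
def IsIdeal {X : Type*} (I : Set (Set X)) : Prop :=
  ∅ ∈ I ∧ (∀ A ∈ I, ∀ B ⊆ A, B ∈ I) ∧ (∀ A ∈ I, ∀ B ∈ I, A ∪ B ∈ I)

/-- `U` has the `I`-pseudo-intersection property: every ω-sequence of members of `U`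
has a pseudo-intersection modulo `I` in `U`. -/
def HasPIP {X : Type*} (U : Filter X) (I : Set (Set X)) : Prop :=
  ∀ A : ℕ → Set X, (∀ n, A n ∈ U) → ∃ B ∈ U, ∀ n, B \ A n ∈ I

/-- A p-point: a nonprincipal ultrafilter on `ω` which has the fin-pseudo-intersection
property. -/
def IsPPoint (U : Ultrafilter ℕ) : Prop :=
  (∀ a : ℕ, (U : Filter ℕ) ≠ pure a) ∧
  ∀ A : ℕ → Set ℕ, (∀ n, A n ∈ U) → ∃ B ∈ U, ∀ n, (B \ A n).Finite

/-- A rapid ultrafilter: a nonprincipal ultrafilter `U` on `ω` such that for every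
increasing `f : ω → ω` there is `X ∈ U` with `|X ∩ f(n)| ≤ n` for all `n`. -/
def IsRapid (U : Ultrafilter ℕ) : Prop :=
  (∀ a : ℕ, (U : Filter ℕ) ≠ pure a) ∧
  ∀ f : ℕ → ℕ, StrictMono f → ∃ X ∈ U, ∀ n, (X ∩ Set.Iio (f n)).ncard ≤ n

/-- The ideal `fin ⊗ fin` on `ω × ω`: all sets with only finitely many infinite
vertical sections. -/
def finOtimesFin : Set (Set (ℕ × ℕ)) :=
  {A | {n : ℕ | {m : ℕ | (n, m) ∈ A}.Infinite}.Finite}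

/-- `FIN`: the nonempty finite subsets of `ω`. -/
abbrev FIN : Type := {s : Finset ℕ // s.Nonempty}

/-- An infinite block sequence: a sequence `⟨x_i : i < ω⟩` in `FIN` with
`max(x_i) < min(x_j)` whenever `i < j`. -/
def IsBlockSeq (X : ℕ → FIN) : Prop :=
  ∀ i j : ℕ, i < j → (X i).1.max' (X i).2 < (X j).1.min' (X j).2

/-- For an infinite block sequence `X = ⟨x_i : i < ω⟩`,
`[X] = {⋃_{i ∈ s} x_i : s a nonempty finite subset of ω}`. -/
def blockSet (X : ℕ → FIN) : Set FIN :=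
  {y | ∃ s : Finset ℕ, s.Nonempty ∧ (y : Finset ℕ) = s.biUnion fun i => (X i).1}

/-- `[X/m]`, where `X/m` is the tail of the block sequence `X` consisting of the
blocks `x_i` with `min(x_i) > m`. -/
def blockSetAbove (X : ℕ → FIN) (m : ℕ) : Set FIN :=
  {y | ∃ s : Finset ℕ, s.Nonempty ∧ (∀ i ∈ s, m < (X i).1.min' (X i).2) ∧
    (y : Finset ℕ) = s.biUnion fun i => (X i).1}

/-- `Y ≤* X` iff `[Y/m] ⊆ [X]` for some `m`. -/
def leStar (Y X : ℕ → FIN) : Prop := ∃ m : ℕ, blockSetAbove Y m ⊆ blockSet X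

/-- A Milliken-Taylor ultrafilter on `FIN`: (1) every member of `U` contains a set
`[X] ∈ U` for some infinite block sequence `X`; (2) every `≤*`-decreasing sequence
of infinite block sequences with `[X_n] ∈ U` has a diagonalization `Y` with
`[Y] ∈ U` and `Y ≤* X_n` for all `n`. -/
def IsMillikenTaylor (U : Ultrafilter FIN) : Prop :=
  (∀ A ∈ U, ∃ X : ℕ → FIN, IsBlockSeq X ∧ blockSet X ⊆ A ∧ blockSet X ∈ U) ∧
  (∀ Xs : ℕ → ℕ → FIN, (∀ n, IsBlockSeq (Xs n)) → (∀ n, blockSet (Xs n) ∈ U) →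
    (∀ n, leStar (Xs (n + 1)) (Xs n)) →
    ∃ Y : ℕ → FIN, IsBlockSeq Y ∧ blockSet Y ∈ U ∧ ∀ n, leStar Y (Xs n))

/-- The least element of a nonempty finite set. -/
abbrev finMin (x : FIN) : ℕ := x.1.min' x.2

/-- The greatest element of a nonempty finite set. -/
abbrev finMax (x : FIN) : ℕ := x.1.max' x.2

theorem finMin_le_finMax (x : FIN) : finMin x ≤ finMax x :=
  Finset.min'_le_max' _ x.2

theorem IsBlockSeq.le_finMin {X : ℕ → FIN} (hX : IsBlockSeq X) (i : ℕ) : i ≤ finMin (X i) := by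
  induction i with
  | zero => exact Nat.zero_le _
  | succ n ih =>
    have h1 := hX n (n + 1) n.lt_succ_self
    have h2 := finMin_le_finMax (X n)
    exact ih.trans_lt (h2.trans_lt h1)

theorem mem_blockSet_self (X : ℕ → FIN) (i : ℕ) : X i ∈ blockSet X :=
  ⟨{i}, Finset.singleton_nonempty i, by simp⟩

theorem finMin_eq_of_mem_blockSet {X : ℕ → FIN} {y : FIN} (hy : y ∈ blockSet X) :
    ∃ i, finMin y = finMin (X i) := by
  obtain ⟨s, -, hs⟩ := hy
  have hmem : finMin y ∈ s.biUnion fun i => (X i).1 := hs ▸ Finset.min'_mem _ y.2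
  obtain ⟨i, hi, hyi⟩ := Finset.mem_biUnion.1 hmem
  refine ⟨i, le_antisymm (Finset.min'_le _ _ ?_) (Finset.min'_le _ _ hyi)⟩
  rw [hs]
  exact Finset.mem_biUnion.2 ⟨i, hi, Finset.min'_mem _ _⟩

theorem mem_blockSetAbove {X : ℕ → FIN} {y : FIN} {m : ℕ} (hy : y ∈ blockSet X)
    (hm : m < finMin y) : y ∈ blockSetAbove X m := by
  obtain ⟨s, hne, hs⟩ := hy
  refine ⟨s, hne, fun i hi => hm.trans_le (Finset.min'_le _ _ ?_), hs⟩
  rw [hs]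
  exact Finset.mem_biUnion.2 ⟨i, hi, Finset.min'_mem _ _⟩

theorem blockSetAbove_subset (X : ℕ → FIN) (m : ℕ) : blockSetAbove X m ⊆ blockSet X :=
  fun _ ⟨s, hne, _, hs⟩ => ⟨s, hne, hs⟩

theorem mem_fubini {X Y : Type*} {U : Filter X} {V : Filter Y} {A : Set (X × Y)} :
    A ∈ fubini U V ↔ {x | {y | (x, y) ∈ A} ∈ V} ∈ U :=
  Iff.rfl

/-- A map `f` admitting a half-inverse `g` that controls bounds is a Tukey reduction. -/
theorem TukeyLE.of_galois {α β : Type*} {ra : α → α → Prop} {rb : β → β → Prop}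
    (f : α → β) (g : β → α) (h : ∀ a b, rb (f a) b → ra a (g b)) : TukeyLE ra rb :=
  ⟨f, fun _ hS ⟨b, hb⟩ => hS ⟨g b, fun a ha => h a b (hb _ (mem_image_of_mem f ha))⟩⟩

/-- An ultrafilter is Tukey below its Fubini product with a proper filter on the right. -/
theorem tukeyLE_fubini {X Y : Type*} (U : Filter X) (V : Filter Y) [V.NeBot] :
    TukeyLE (filtRel U) (filtRel (fubini U V)) := by
  refine TukeyLE.of_galois
    (fun A => ⟨{p | p.1 ∈ A.1}, mem_fubini.2 (Filter.mem_of_superset A.2 fun x hx => ?_)⟩)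
    (fun B => ⟨_, mem_fubini.1 B.2⟩) fun A B hBA x hx => ?_
  · exact Filter.mem_of_superset Filter.univ_mem fun y _ => hx
  · obtain ⟨y, hy⟩ := Filter.nonempty_of_mem hx
    exact hBA hy

namespace IsMillikenTaylor

variable {U : Ultrafilter FIN}

theorem tail_mem (hU : IsMillikenTaylor U) (m : ℕ) : {x : FIN | m < finMin x} ∈ U := by
  by_contra hm
  obtain ⟨X, hX, hsub, -⟩ := hU.1 _ (Ultrafilter.compl_mem_iff_notMem.2 hm)
  exact hsub (mem_blockSet_self X (m + 1)) (hX.le_finMin (m + 1))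

/-- Almost every `x` is long relative to its minimum. -/
theorem long_mem (hU : IsMillikenTaylor U) {h : ℕ → ℕ} (hh : Monotone h) :
    {x : FIN | h (finMin x) < finMax x} ∈ U := by
  by_contra hm
  obtain ⟨X, hX, hsub, -⟩ := hU.1 _ (Ultrafilter.compl_mem_iff_notMem.2 hm)
  set j := h (finMin (X 0)) + 1 with hj
  let y : FIN := ⟨(X 0).1 ∪ (X j).1, (X 0).2.mono Finset.subset_union_left⟩
  refine hsub (a := y) ⟨{0, j}, by simp, by simp [y]⟩ ?_
  have h1 : finMin y ≤ finMin (X 0) :=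
    Finset.min'_le _ _ (Finset.mem_union_left _ (Finset.min'_mem _ _))
  have h2 : finMin (X j) ≤ finMax y :=
    Finset.le_max' _ _ (Finset.mem_union_right _ (Finset.min'_mem _ _))
  have h3 := hX.le_finMin j
  have h4 := hh h1
  change h (finMin y) < finMax y
  omega

/-- Rapidity of the minima: some member of `U` has all its minima `h`-spread. -/
theorem exists_spread (hU : IsMillikenTaylor U) {h : ℕ → ℕ} (hh : Monotone h) :
    ∃ C ∈ U, ∀ a ∈ C, ∀ b ∈ C, finMin a < finMin b → h (finMin a) < finMin b := by
  obtain ⟨X, hX, hsub, hXU⟩ := hU.1 _ (hU.long_mem hh)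
  refine ⟨blockSet X, hXU, fun a ha b hb hab => ?_⟩
  obtain ⟨i, hi⟩ := finMin_eq_of_mem_blockSet ha
  obtain ⟨j, hj⟩ := finMin_eq_of_mem_blockSet hb
  rw [hi, hj] at hab ⊢
  have hij : i < j := by
    by_contra hle
    rcases (not_lt.1 hle).eq_or_lt with rfl | hlt
    · exact lt_irrefl _ hab
    · exact absurd ((finMin_le_finMax _).trans_lt (hX j i hlt)) hab.not_gt
  have h1 : h (finMin (X i)) < finMax (X i) := hsub (mem_blockSet_self X i)
  exact h1.trans (hX i j hij)

/-- `U` has the pseudo-intersection property modulo sets with bounded minima. -/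
theorem exists_pseudoIntersection (hU : IsMillikenTaylor U) (A : ℕ → Set FIN)
    (hA : ∀ n, A n ∈ U) : ∃ B ∈ U, ∀ n, ∃ m, ∀ y ∈ B, m < finMin y → y ∈ A n := by
  have : Nonempty FIN := ⟨⟨{0}, Finset.singleton_nonempty 0⟩⟩
  choose! F hF hFsub hFU using hU.1
  let D : ℕ → {S : Set FIN // S ∈ U} := fun n =>
    Nat.rec ⟨A 0, hA 0⟩
      (fun n S => ⟨A (n + 1) ∩ blockSet (F S.1), Filter.inter_mem (hA _) (hFU _ S.2)⟩) n
  have hDA : ∀ n, (D n).1 ⊆ A n := fun n => by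
    cases n with
    | zero => exact subset_rfl
    | succ n => exact inter_subset_left
  obtain ⟨Y, -, hYU, hYle⟩ := hU.2 (fun n => F (D n).1) (fun n => hF _ (D n).2)
    (fun n => hFU _ (D n).2) fun n =>
      ⟨0, (blockSetAbove_subset _ _).trans ((hFsub _ (D (n + 1)).2).trans inter_subset_right)⟩
  refine ⟨blockSet Y, hYU, fun n => ?_⟩
  obtain ⟨m, hm⟩ := hYle n
  exact ⟨m, fun y hy hmy => hDA n (hFsub _ (D n).2 (hm (mem_blockSetAbove hy hmy)))⟩

theorem exists_finMin_lt (hU : IsMillikenTaylor U) {D : Set FIN} (hD : D ∈ U) (n : ℕ) :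
    ∃ a ∈ D, n < finMin a :=
  Filter.nonempty_of_mem (Filter.inter_mem hD (hU.tail_mem n))

/-- Each member of the Fubini square is captured by a member of `U` whose `U`-large subsets
`D` satisfy: `(x, y) ∈ A` as soon as `x, y ∈ D` and two distinct minima of `D` lie between
`max x` and `min y`. -/
theorem exists_capture (hU : IsMillikenTaylor U) {A : Set (FIN × FIN)}
    (hA : A ∈ fubini (U : Filter FIN) (U : Filter FIN)) :
    ∃ C ∈ U, ∀ x ∈ C, ∀ y ∈ C, ∀ a ∈ C, ∀ b ∈ C,
      finMax x < finMin a → finMin a < finMin b → finMin b < finMin y → (x, y) ∈ A := by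
  have hA0 := mem_fubini.1 hA
  set A0 : Set FIN := {x | {y | (x, y) ∈ A} ∈ (U : Filter FIN)}
  have hfin : ∀ n : ℕ, {x : FIN | finMax x ≤ n}.Finite := fun n =>
    Set.Finite.of_injOn (f := Subtype.val) (t := ↑(Finset.range (n + 1)).powerset)
      (fun x hx => Finset.mem_coe.2 (Finset.mem_powerset.2 fun k hk =>
        Finset.mem_range.2 (Nat.lt_succ_of_le ((Finset.le_max' _ _ hk).trans hx))))
      Subtype.val_injective.injOn (Finset.finite_toSet _)
  obtain ⟨B, hBU, hB⟩ := hU.exists_pseudoIntersection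
    (fun n => ⋂ x ∈ {x : FIN | finMax x ≤ n} ∩ A0, {y | (x, y) ∈ A})
    fun n => (Filter.biInter_mem ((hfin n).inter_of_left A0)).2 fun x hx => hx.2
  choose m hm using hB
  obtain ⟨C, hCU, hC⟩ := hU.exists_spread (partialSups m).monotone
  refine ⟨A0 ∩ B ∩ C, Filter.inter_mem (Filter.inter_mem hA0 hBU) hCU,
    fun x hx y hy a ha b hb hxa hab hby => ?_⟩
  have h1 := hC a ha.2 b hb.2 hab
  have h2 := le_partialSups_of_le m hxa.le
  exact mem_iInter₂.1 (hm (finMax x) y hy.1.2 (by omega)) x ⟨le_refl (finMax x), hx.1.1⟩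

theorem fubini_tukeyLE (hU : IsMillikenTaylor U) :
    TukeyLE (filtRel (fubini (U : Filter FIN) (U : Filter FIN))) (filtRel (U : Filter FIN)) := by
  choose! f hfU hf using fun A => hU.exists_capture (A := A)
  refine TukeyLE.of_galois (fun A => ⟨f A.1, hfU _ A.2⟩)
    (fun D => ⟨{p | p.1 ∈ D.1 ∧ p.2 ∈ D.1 ∧ ∃ a ∈ D.1, ∃ b ∈ D.1,
      finMax p.1 < finMin a ∧ finMin a < finMin b ∧ finMin b < finMin p.2}, ?_⟩) ?_
  · refine mem_fubini.2 (Filter.mem_of_superset D.2 fun x hx => ?_)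
    obtain ⟨a, ha, hxa⟩ := hU.exists_finMin_lt D.2 (finMax x)
    obtain ⟨b, hb, hab⟩ := hU.exists_finMin_lt D.2 (finMin a)
    exact Filter.mem_of_superset (Filter.inter_mem D.2 (hU.tail_mem (finMin b)))
      fun y hy => ⟨hx, hy.1, a, ha, b, hb, hxa, hab, hy.2⟩
  · rintro A D hDA ⟨x, y⟩ ⟨hx, hy, a, ha, b, hb, hxa, hab, hby⟩
    exact hf _ A.2 x (hDA hx) y (hDA hy) a (hDA ha) b (hDA hb) hxa hab hby

end IsMillikenTaylor

/-- If `U` is a Milliken-Taylor ultrafilter on `FIN`, then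
`U·U ≡_T U`. -/
theorem stmt18 (U : Ultrafilter FIN) (hU : IsMillikenTaylor U) :
    TukeyEquiv (filtRel (fubini (U : Filter FIN) (U : Filter FIN)))
      (filtRel (U : Filter FIN)) := by
  exact ⟨hU.fubini_tukeyLE, tukeyLE_fubini _ _⟩
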